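/- Let X be a real random variable with Gaussian distribution N(m, s²), s > 0, let a < b be censoring limits, and set a* = (a − m)/s, b* = (b − m)/s, and P = Φ(b*) − Φ(a*). Then the variance of the censored variable satisfies Var(clip_{a,b}(X)) = a²·Φ(a*) + b²·(1 − Φ(b*)) + (m² + s²)·P + 2ms·(φ(a*) − φ(b*)) + s²·(a*·φ(a*) − b*·φ(b*)) − (a·Φ(a*) + b·(1 − Φ(b*)) + m·P + s·(φ(a*) − φ(b*)))². -/

import Mathlib

open MeasureTheory ProbabilityTheory Real

/-- The standard normal cumulative distribution function Φ. -/
noncomputable def stdNormalCDF (x : ℝ) : ℝ :=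
  ((gaussianReal 0 1) (Set.Iic x)).toReal

/-- The standard normal probability density function φ. -/
noncomputable def stdNormalPDF (x : ℝ) : ℝ :=
  gaussianPDFReal 0 1 x

/-- The censoring (clipping) map: `clip a b x = x` if `a < x < b`,
`= a` if `x ≤ a`, `= b` if `x ≥ b` (for `a < b`). -/
noncomputable def clip (a b x : ℝ) : ℝ := max a (min b x)

lemma stdNormalPDF_eq (x : ℝ) :
    stdNormalPDF x = (√(2 * π))⁻¹ * rexp (-x ^ 2 / 2) := by
  simp [stdNormalPDF, gaussianPDFReal]

lemma hasDerivAt_stdNormalPDF (x : ℝ) :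
    HasDerivAt stdNormalPDF (-x * stdNormalPDF x) x := by
  have h : HasDerivAt (fun y : ℝ => (√(2 * π))⁻¹ * rexp (-y ^ 2 / 2))
      ((√(2 * π))⁻¹ * (rexp (-x ^ 2 / 2) * (-(2 * x) / 2))) x := by
    have h2 : HasDerivAt (fun y : ℝ => -y ^ 2 / 2) (-(2 * x) / 2) x := by
      simpa using ((hasDerivAt_pow 2 x).neg).div_const 2
    exact h2.exp.const_mul _
  rw [funext stdNormalPDF_eq]
  exact h.congr_deriv (by ring)

lemma continuous_stdNormalPDF : Continuous stdNormalPDF :=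
  continuous_iff_continuousAt.2 fun x => (hasDerivAt_stdNormalPDF x).continuousAt

lemma setIntegral_gaussianReal_zero_one (S : Set ℝ) (hS : MeasurableSet S) (g : ℝ → ℝ) :
    ∫ z in S, g z ∂(gaussianReal 0 1) = ∫ z in S, stdNormalPDF z * g z := by
  rw [← integral_indicator hS, integral_gaussianReal_eq_integral_smul one_ne_zero,
    ← integral_indicator hS]
  congr 1 with z
  by_cases hz : z ∈ S <;> simp [hz, stdNormalPDF]

lemma gaussianReal_real_Ioc {α β : ℝ} (h : α ≤ β) :
    (gaussianReal 0 1).real (Set.Ioc α β) = stdNormalCDF β - stdNormalCDF α := by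
  rw [← Set.Iic_sdiff_Iic, measureReal_sdiff (Set.Iic_subset_Iic.2 h) measurableSet_Iic]
  rfl

lemma gaussianReal_real_Ioi (β : ℝ) :
    (gaussianReal 0 1).real (Set.Ioi β) = 1 - stdNormalCDF β := by
  rw [← Set.compl_Iic, probReal_compl_eq_one_sub measurableSet_Iic]
  rfl

lemma setIntegral_Ioc_quadratic_gaussianReal {α β : ℝ} (h : α ≤ β) (c₀ c₁ c₂ : ℝ) :
    ∫ z in Set.Ioc α β, (c₀ + c₁ * z + c₂ * z ^ 2) ∂(gaussianReal 0 1) =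
      (c₀ + c₂) * (stdNormalCDF β - stdNormalCDF α)
        + c₁ * (stdNormalPDF α - stdNormalPDF β)
        + c₂ * (α * stdNormalPDF α - β * stdNormalPDF β) := by
  have hcont : Continuous fun z => c₁ * z + c₂ * (z ^ 2 - 1) := by fun_prop
  have hint : IntegrableOn (fun z => c₁ * z + c₂ * (z ^ 2 - 1)) (Set.Ioc α β)
      (gaussianReal 0 1) :=
    (hcont.continuousOn.integrableOn_compact isCompact_Icc).mono_set Set.Ioc_subset_Icc_self
  have hFTC : ∫ z in Set.Ioc α β, (c₁ * z + c₂ * (z ^ 2 - 1)) ∂(gaussianReal 0 1) =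
      -(c₁ + c₂ * β) * stdNormalPDF β - -(c₁ + c₂ * α) * stdNormalPDF α := by
    rw [setIntegral_gaussianReal_zero_one _ measurableSet_Ioc,
      ← intervalIntegral.integral_of_le h]
    refine intervalIntegral.integral_eq_sub_of_hasDerivAt
      (f := fun z => -(c₁ + c₂ * z) * stdNormalPDF z) (fun z _ => ?_)
      ((continuous_stdNormalPDF.mul hcont).intervalIntegrable _ _)
    have hlin : HasDerivAt (fun z : ℝ => -(c₁ + c₂ * z)) (-c₂) z := by
      exact (((hasDerivAt_id z).const_mul c₂).const_add c₁).neg.congr_deriv (by simp)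
    exact (hlin.mul (hasDerivAt_stdNormalPDF z)).congr_deriv (by ring)
  have hsplit : ∀ z : ℝ, c₀ + c₁ * z + c₂ * z ^ 2 =
      (c₀ + c₂) + (c₁ * z + c₂ * (z ^ 2 - 1)) := fun z => by ring
  simp_rw [hsplit]
  rw [integral_add (integrable_const _) hint, hFTC, setIntegral_const,
    gaussianReal_real_Ioc h, smul_eq_mul]
  ring

lemma continuous_clip (a b : ℝ) : Continuous (clip a b) := by
  unfold clip
  fun_prop

lemma clip_mem_Icc {a b : ℝ} (hab : a ≤ b) (x : ℝ) : clip a b x ∈ Set.Icc a b :=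
  ⟨le_max_left _ _, max_le hab (min_le_left _ _)⟩

lemma gaussianReal_eq_map_standard (m s : ℝ) :
    gaussianReal m ((s ^ 2).toNNReal) = (gaussianReal 0 1).map (fun z => m + s * z) := by
  have h : (fun z : ℝ => m + s * z) = (fun y => m + y) ∘ (fun z => s * z) := rfl
  rw [h, ← Measure.map_map (by fun_prop) (by fun_prop), gaussianReal_map_const_mul,
    gaussianReal_map_const_add]
  congr 1
  · simp
  · ext
    simp [sq_nonneg]

/-- Expectation of a quadratic polynomial of a censored Gaussian variable. -/
lemma integral_quadratic_clip_gaussianReal {m s a b : ℝ} (hs : 0 < s) (hab : a < b)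
    (p q : ℝ) :
    ∫ x, (p * clip a b x + q * clip a b x ^ 2) ∂(gaussianReal m ((s ^ 2).toNNReal)) =
      (p * a + q * a ^ 2) * stdNormalCDF ((a - m) / s)
        + (p * b + q * b ^ 2) * (1 - stdNormalCDF ((b - m) / s))
        + ((p * m + q * (m ^ 2 + s ^ 2))
              * (stdNormalCDF ((b - m) / s) - stdNormalCDF ((a - m) / s))
          + (p * s + q * (2 * m * s)) * (stdNormalPDF ((a - m) / s) - stdNormalPDF ((b - m) / s))
          + q * s ^ 2 * ((a - m) / s * stdNormalPDF ((a - m) / s)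
            - (b - m) / s * stdNormalPDF ((b - m) / s))) := by
  have hc := continuous_clip a b
  have hα : ∀ z, z ≤ (a - m) / s ↔ m + s * z ≤ a := fun z => by
    rw [le_div_iff₀ hs]
    constructor <;> intro h <;> linarith
  have hβ : ∀ z, z ≤ (b - m) / s ↔ m + s * z ≤ b := fun z => by
    rw [le_div_iff₀ hs]
    constructor <;> intro h <;> linarith
  have hαβ : (a - m) / s ≤ (b - m) / s := by gcongr
  rw [gaussianReal_eq_map_standard, integral_map (by fun_prop) (by fun_prop)]
  set α := (a - m) / s
  set β := (b - m) / s
  set G : ℝ → ℝ := fun z => p * clip a b (m + s * z) + q * clip a b (m + s * z) ^ 2 with hG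
  have hGc : Continuous G := by fun_prop
  have hGint : Integrable G (gaussianReal 0 1) := by
    refine Integrable.of_bound hGc.aestronglyMeasurable
      (|p| * max |a| |b| + |q| * max |a| |b| ^ 2) (ae_of_all _ fun z => ?_)
    obtain ⟨h1, h2⟩ := clip_mem_Icc hab.le (m + s * z)
    have h3 : |clip a b (m + s * z)| ≤ max |a| |b| := abs_le_max_abs_abs h1 h2
    calc ‖G z‖ ≤ |p * clip a b (m + s * z)| + |q * clip a b (m + s * z) ^ 2| := abs_add_le _ _
      _ = |p| * |clip a b (m + s * z)| + |q| * |clip a b (m + s * z)| ^ 2 := by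
        rw [abs_mul, abs_mul, abs_pow]
      _ ≤ _ := by gcongr
  have hlow : ∫ z in Set.Iic α, G z ∂(gaussianReal 0 1) =
      (p * a + q * a ^ 2) * stdNormalCDF α := by
    have : Set.EqOn G (fun _ => p * a + q * a ^ 2) (Set.Iic α) := fun z hz => by
      have hz' := (hα z).1 hz
      have : clip a b (m + s * z) = a :=
        max_eq_left ((min_le_right _ _).trans hz')
      simp only [hG, this]
    rw [setIntegral_congr_fun measurableSet_Iic this, setIntegral_const, smul_eq_mul, mul_comm]
    rfl
  have hhigh : ∫ z in Set.Ioi β, G z ∂(gaussianReal 0 1) =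
      (p * b + q * b ^ 2) * (1 - stdNormalCDF β) := by
    have : Set.EqOn G (fun _ => p * b + q * b ^ 2) (Set.Ioi β) := fun z hz => by
      have hz' : b < m + s * z := not_le.1 fun h => not_le.2 hz ((hβ z).2 h)
      have : clip a b (m + s * z) = b := by
        rw [clip, min_eq_left hz'.le, max_eq_right hab.le]
      simp only [hG, this]
    rw [setIntegral_congr_fun measurableSet_Ioi this, setIntegral_const, smul_eq_mul, mul_comm,
      gaussianReal_real_Ioi]
  have hmid : ∫ z in Set.Ioc α β, G z ∂(gaussianReal 0 1) =
      ∫ z in Set.Ioc α β, ((p * m + q * m ^ 2) + (p * s + q * (2 * m * s)) * z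
        + q * s ^ 2 * z ^ 2) ∂(gaussianReal 0 1) := by
    refine setIntegral_congr_fun measurableSet_Ioc fun z hz => ?_
    have hz1 : a < m + s * z := not_le.1 fun h => not_le.2 hz.1 ((hα z).2 h)
    have : clip a b (m + s * z) = m + s * z := by
      rw [clip, min_eq_right ((hβ z).1 hz.2), max_eq_right hz1.le]
    simp only [hG, this]
    ring
  have hIic : ∫ z in Set.Iic β, G z ∂(gaussianReal 0 1) =
      ∫ z in Set.Iic α, G z ∂(gaussianReal 0 1)
        + ∫ z in Set.Ioc α β, G z ∂(gaussianReal 0 1) := by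
    rw [← Set.Iic_union_Ioc_eq_Iic hαβ]
    exact setIntegral_union (Set.Iic_disjoint_Ioc le_rfl) measurableSet_Ioc
      hGint.integrableOn hGint.integrableOn
  rw [← integral_add_compl measurableSet_Iic hGint (s := Set.Iic β), Set.compl_Iic, hIic, hlow,
    hhigh, hmid, setIntegral_Ioc_quadratic_gaussianReal hαβ]
  ring

theorem censored_variance {Ω : Type*} [MeasureSpace Ω]
    [IsProbabilityMeasure (ℙ : Measure Ω)]
    (X : Ω → ℝ) (hXm : Measurable X) (m s a b : ℝ) (hs : 0 < s) (hab : a < b)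
    (hX : Measure.map X ℙ = gaussianReal m ((s ^ 2).toNNReal)) :
    variance (fun ω => clip a b (X ω)) ℙ =
      a ^ 2 * stdNormalCDF ((a - m) / s) + b ^ 2 * (1 - stdNormalCDF ((b - m) / s))
        + (m ^ 2 + s ^ 2) * (stdNormalCDF ((b - m) / s) - stdNormalCDF ((a - m) / s))
        + 2 * m * s * (stdNormalPDF ((a - m) / s) - stdNormalPDF ((b - m) / s))
        + s ^ 2 * ((a - m) / s * stdNormalPDF ((a - m) / s)
            - (b - m) / s * stdNormalPDF ((b - m) / s))
        - (a * stdNormalCDF ((a - m) / s) + b * (1 - stdNormalCDF ((b - m) / s))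
            + m * (stdNormalCDF ((b - m) / s) - stdNormalCDF ((a - m) / s))
            + s * (stdNormalPDF ((a - m) / s) - stdNormalPDF ((b - m) / s))) ^ 2 := by
  have hc := continuous_clip a b
  have hL2 : MemLp (fun ω => clip a b (X ω)) 2 (ℙ : Measure Ω) :=
    memLp_of_bounded (ae_of_all _ fun ω => clip_mem_Icc hab.le (X ω))
      (hc.measurable.comp hXm).aestronglyMeasurable 2
  have hE (p q : ℝ) : ∫ ω, (p * clip a b (X ω) + q * clip a b (X ω) ^ 2) ∂(ℙ : Measure Ω) =
      ∫ x, (p * clip a b x + q * clip a b x ^ 2) ∂(gaussianReal m ((s ^ 2).toNNReal)) := by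
    rw [← hX, integral_map hXm.aemeasurable (by fun_prop)]
  have h1 := (hE 1 0).trans (integral_quadratic_clip_gaussianReal hs hab 1 0)
  have h2 := (hE 0 1).trans (integral_quadratic_clip_gaussianReal hs hab 0 1)
  simp only [one_mul, zero_mul, add_zero, zero_add] at h1 h2
  rw [variance_eq_sub hL2]
  simp only [Pi.pow_apply]
  rw [h1, h2]
  ring
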